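/- If a nonzero μ ∈ V_n is a soliton, then there exists a real number t > 0 such that every eigenvalue of t·D_μ is a rational number, where D_μ := M_μ − c_μ·I and c_μ := −Tr(M_μ²)/‖μ‖². -/

import Mathlib

open Matrix

noncomputable section

/-- `Vn n` is the space of `n`-dimensional commutative complex algebras, i.e. symmetric
ℂ-bilinear maps `ℂⁿ × ℂⁿ → ℂⁿ`, encoded by structure constants with respect to the
standard basis: `μ i j k` is the `e k`-coordinate of `μ(e i, e j)`. -/
abbrev Vn (n : ℕ) : Type := Fin n → Fin n → Fin n → ℂ

namespace Vn

variable {n : ℕ}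

/-- symmetry (commutativity) of the multiplication -/
def IsSymm (μ : Vn n) : Prop := ∀ i j k, μ i j k = μ j i k

/-- the product `μ(x, y)` -/
def mul (μ : Vn n) (x y : Fin n → ℂ) : Fin n → ℂ :=
  fun k => ∑ i, ∑ j, x i * y j * μ i j k

/-- left multiplication `L^μ_x`, as a matrix -/
def L (μ : Vn n) (x : Fin n → ℂ) : Matrix (Fin n) (Fin n) ℂ :=
  Matrix.of fun k j => ∑ i, x i * μ i j k

/-- the standard Hermitian inner product on `ℂⁿ` (linear in the first variable) -/
def herm (x y : Fin n → ℂ) : ℂ := ∑ i, x i * star (y i)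

/-- the moment matrix `M_μ = -2 ∑ᵢ (L_{xᵢ})* L_{xᵢ} + ∑ᵢ L_{xᵢ} (L_{xᵢ})*`,
computed with respect to the standard orthonormal basis of `ℂⁿ` -/
def Mmat (μ : Vn n) : Matrix (Fin n) (Fin n) ℂ :=
  (-2 : ℂ) • ∑ i, (L μ (Pi.single i 1))ᴴ * L μ (Pi.single i 1)
    + ∑ i, L μ (Pi.single i 1) * (L μ (Pi.single i 1))ᴴ

/-- the Hermitian product on `Vn n` -/
def innerV (μ ν : Vn n) : ℂ := ∑ i, ∑ j, ∑ k, μ i j k * star (ν i j k)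

/-- the squared norm `‖μ‖²` on `Vn n` -/
def normSqV (μ : Vn n) : ℝ := ∑ i, ∑ j, ∑ k, Complex.normSq (μ i j k)

/-- the infinitesimal change-of-basis action of `gl(n, ℂ)` on `Vn n`:
`(A·μ)(x,y) = A(μ(x,y)) - μ(Ax,y) - μ(x,Ay)` -/
def glAct (A : Matrix (Fin n) (Fin n) ℂ) (μ : Vn n) : Vn n :=
  fun i j k =>
    (A *ᵥ mul μ (Pi.single i 1) (Pi.single j 1)
      - mul μ (A *ᵥ Pi.single i 1) (Pi.single j 1)
      - mul μ (Pi.single i 1) (A *ᵥ Pi.single j 1)) k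

/-- the change-of-basis action of `GL(n, ℂ)` on `Vn n`:
`(g·μ)(x,y) = g(μ(g⁻¹x, g⁻¹y))` -/
def gAct (g : GL (Fin n) ℂ) (μ : Vn n) : Vn n :=
  fun i j k =>
    ((g : Matrix (Fin n) (Fin n) ℂ) *ᵥ
      mul μ ((↑g⁻¹ : Matrix (Fin n) (Fin n) ℂ) *ᵥ Pi.single i 1)
            ((↑g⁻¹ : Matrix (Fin n) (Fin n) ℂ) *ᵥ Pi.single j 1)) k

/-- the `GL(n,ℂ)`-orbit (isomorphism class) of `μ` -/
def orbit (μ : Vn n) : Set (Vn n) := { ν | ∃ g : GL (Fin n) ℂ, ν = gAct g μ }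

/-- `D` is a derivation of `μ` -/
def IsDeriv (μ : Vn n) (D : Matrix (Fin n) (Fin n) ℂ) : Prop :=
  ∀ x y, D *ᵥ mul μ x y = mul μ (D *ᵥ x) y + mul μ x (D *ᵥ y)

/-- the associator `(a,b,c) = (ab)c - a(bc)` -/
def assoc (μ : Vn n) (a b c : Fin n → ℂ) : Fin n → ℂ :=
  mul μ (mul μ a b) c - mul μ a (mul μ b c)

/-- `μ` is a Jordan algebra: commutative and satisfying the linearized Jordan identity
`(ab,c,d) + (bd,c,a) + (da,c,b) = 0` -/
def IsJordan (μ : Vn n) : Prop :=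
  IsSymm μ ∧ ∀ a b c d : Fin n → ℂ,
    assoc μ (mul μ a b) c d + assoc μ (mul μ b d) c a + assoc μ (mul μ d a) c b = 0

/-- `μ` is a soliton: `μ ≠ 0` and `M_μ · μ ∈ ℝ μ` -/
def IsSoliton (μ : Vn n) : Prop :=
  μ ≠ 0 ∧ ∃ c : ℝ, glAct (Mmat μ) μ = (c : ℂ) • μ

/-- the constant `c_μ = -Tr(M_μ²)/‖μ‖²` -/
def cconst (μ : Vn n) : ℝ := -(Matrix.trace (Mmat μ * Mmat μ)).re / normSqV μ

/-- `D_μ = M_μ - c_μ • I` -/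
def Dmat (μ : Vn n) : Matrix (Fin n) (Fin n) ℂ := Mmat μ - (cconst μ : ℂ) • 1

/-- the energy `E_n(μ) = Tr(M_μ²)/‖μ‖⁴` -/
def energy (μ : Vn n) : ℝ := (Matrix.trace (Mmat μ * Mmat μ)).re / (normSqV μ) ^ 2

/-- the trace form `τ_μ(x, y) = Tr L_{μ(x,y)}` -/
def traceForm (μ : Vn n) (x y : Fin n → ℂ) : ℂ := Matrix.trace (L μ (mul μ x y))

/-- nondegeneracy of the trace form (Albert's criterion for semisimplicity) -/
def TraceFormNondeg (μ : Vn n) : Prop := ∀ x, (∀ y, traceForm μ x y = 0) → x = 0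

end Vn


namespace Vn

variable {n : ℕ}

lemma mul_add_left (μ : Vn n) (x y z : Fin n → ℂ) : mul μ (x + y) z = mul μ x z + mul μ y z := by
  ext k; simp [mul, add_mul, Finset.sum_add_distrib]

lemma mul_add_right (μ : Vn n) (x y z : Fin n → ℂ) : mul μ x (y + z) = mul μ x y + mul μ x z := by
  ext k; simp [mul, mul_add, add_mul, Finset.sum_add_distrib]

lemma mul_smul_left (μ : Vn n) (a : ℂ) (x y : Fin n → ℂ) : mul μ (a • x) y = a • mul μ x y := by
  ext k; simp [mul, Finset.mul_sum, mul_assoc]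

lemma mul_smul_right (μ : Vn n) (a : ℂ) (x y : Fin n → ℂ) : mul μ x (a • y) = a • mul μ x y := by
  ext k; simp [mul, Finset.mul_sum, mul_assoc, mul_left_comm]

/-- The multiplication of `μ` as a bilinear map. -/
def mulBilin (μ : Vn n) : (Fin n → ℂ) →ₗ[ℂ] (Fin n → ℂ) →ₗ[ℂ] (Fin n → ℂ) :=
  LinearMap.mk₂ ℂ (mul μ) (mul_add_left μ) (mul_smul_left μ) (mul_add_right μ) (mul_smul_right μ)

/-- The defect of `A` from being a derivation of `μ`, as a bilinear map. -/
def derivDefect (μ : Vn n) (A : Matrix (Fin n) (Fin n) ℂ) :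
    (Fin n → ℂ) →ₗ[ℂ] (Fin n → ℂ) →ₗ[ℂ] (Fin n → ℂ) :=
  (mulBilin μ).compr₂ A.mulVecLin - (mulBilin μ).comp A.mulVecLin
    - (mulBilin μ).compl₂ A.mulVecLin

lemma derivDefect_apply (μ : Vn n) (A : Matrix (Fin n) (Fin n) ℂ) (x y : Fin n → ℂ) :
    derivDefect μ A x y = A *ᵥ mul μ x y - mul μ (A *ᵥ x) y - mul μ x (A *ᵥ y) := rfl

lemma derivDefect_eq_zero_iff (μ : Vn n) (A : Matrix (Fin n) (Fin n) ℂ) :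
    derivDefect μ A = 0 ↔ IsDeriv μ A := by
  simp only [IsDeriv, LinearMap.ext_iff₂, derivDefect_apply, sub_sub, sub_eq_zero,
    LinearMap.zero_apply]

lemma isDeriv_iff_glAct_eq_zero (μ : Vn n) (A : Matrix (Fin n) (Fin n) ℂ) :
    IsDeriv μ A ↔ glAct A μ = 0 := by
  rw [← derivDefect_eq_zero_iff]
  constructor
  · intro h
    funext i j k
    exact congrFun (LinearMap.congr_fun₂ h (Pi.single i 1) (Pi.single j 1)) k
  · intro h
    refine (Pi.basisFun ℂ (Fin n)).ext fun i => (Pi.basisFun ℂ (Fin n)).ext fun j => ?_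
    simp only [Pi.basisFun_apply]
    exact congrFun₂ h i j

lemma IsDeriv.of_basis {μ : Vn n} {A : Matrix (Fin n) (Fin n) ℂ}
    (b : Module.Basis (Fin n) ℂ (Fin n → ℂ))
    (h : ∀ i j, A *ᵥ mul μ (b i) (b j) = mul μ (A *ᵥ b i) (b j) + mul μ (b i) (A *ᵥ b j)) :
    IsDeriv μ A := by
  rw [← derivDefect_eq_zero_iff]
  refine b.ext fun i => b.ext fun j => ?_
  rw [derivDefect_apply, h]
  simp

lemma IsDeriv.smul {μ : Vn n} {A : Matrix (Fin n) (Fin n) ℂ} (h : IsDeriv μ A) (c : ℂ) :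
    IsDeriv μ (c • A) := by
  intro x y
  simp [smul_mulVec, h x y, mul_smul_left, mul_smul_right]

lemma glAct_apply (A : Matrix (Fin n) (Fin n) ℂ) (μ : Vn n) (i j k : Fin n) :
    glAct A μ i j k = ∑ l, A k l * μ i j l - ∑ l, A l i * μ l j k - ∑ l, A l j * μ i l k := by
  simp [glAct, mul, mulVec, dotProduct, Pi.single_apply]

lemma Mmat_apply (μ : Vn n) (k l : Fin n) :
    Mmat μ k l = -2 * ∑ i, ∑ m, star (μ i k m) * μ i l m
      + ∑ i, ∑ m, μ i m k * star (μ i m l) := by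
  simp [Mmat, L, Matrix.sum_apply, Matrix.mul_apply, Pi.single_apply]

lemma isHermitian_Mmat (μ : Vn n) : (Mmat μ).IsHermitian := by
  ext k l
  simp [Mmat_apply, mul_comm]

lemma innerV_glAct (μ : Vn n) (hμ : IsSymm μ) (A : Matrix (Fin n) (Fin n) ℂ) :
    innerV (glAct A μ) μ = trace (A * Mmat μ) := by
  have h₁ : ∑ i, ∑ j, ∑ k, (∑ l, A k l * μ i j l) * star (μ i j k)
      = ∑ k, ∑ l, A k l * ∑ i, ∑ j, μ i j l * star (μ i j k) := by
    simp only [Finset.sum_mul, Finset.mul_sum, mul_assoc]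
    rw [Finset.sum_congr rfl fun i _ => Finset.sum_comm, Finset.sum_comm]
    refine Finset.sum_congr rfl fun k _ => ?_
    rw [Finset.sum_congr rfl fun i _ => Finset.sum_comm, Finset.sum_comm]
  have h₂ : ∑ i, ∑ j, ∑ k, (∑ l, A l j * μ i l k) * star (μ i j k)
      = ∑ l, ∑ j, A l j * ∑ i, ∑ k, star (μ i j k) * μ i l k := by
    simp only [Finset.sum_mul, Finset.mul_sum, mul_assoc]
    rw [Finset.sum_comm]
    conv_rhs => rw [Finset.sum_comm]
    refine Finset.sum_congr rfl fun j _ => ?_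
    rw [Finset.sum_congr rfl fun i _ => Finset.sum_comm, Finset.sum_comm]
    simp only [mul_comm, mul_left_comm]
  have h₃ : ∑ i, ∑ j, ∑ k, (∑ l, A l i * μ l j k) * star (μ i j k)
      = ∑ i, ∑ j, ∑ k, (∑ l, A l j * μ i l k) * star (μ i j k) := by
    rw [Finset.sum_comm]
    refine Finset.sum_congr rfl fun j _ => Finset.sum_congr rfl fun i _ =>
      Finset.sum_congr rfl fun k _ => ?_
    rw [hμ i j k, Finset.sum_congr rfl fun l _ => by rw [hμ l j k]]
  simp only [innerV, glAct_apply, sub_mul, Finset.sum_sub_distrib]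
  rw [h₃, h₁, h₂]
  simp only [trace, diag, Matrix.mul_apply, Mmat_apply, mul_add, Finset.sum_add_distrib,
    mul_left_comm _ (-2 : ℂ), ← Finset.mul_sum]
  ring

lemma innerV_self (μ : Vn n) : innerV μ μ = normSqV μ := by
  simp [innerV, normSqV, Complex.mul_conj]

lemma normSqV_pos {μ : Vn n} (h : μ ≠ 0) : 0 < normSqV μ := by
  obtain ⟨i, hi⟩ := Function.ne_iff.1 h
  obtain ⟨j, hj⟩ := Function.ne_iff.1 hi
  obtain ⟨k, hk⟩ := Function.ne_iff.1 hj
  have h₀ : ∀ i j k, 0 ≤ Complex.normSq (μ i j k) := fun _ _ _ => Complex.normSq_nonneg _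
  have h₁ : ∀ i j, 0 ≤ ∑ k, Complex.normSq (μ i j k) := fun i j =>
    Finset.sum_nonneg fun k _ => h₀ i j k
  have h₂ : ∀ i, 0 ≤ ∑ j, ∑ k, Complex.normSq (μ i j k) := fun i =>
    Finset.sum_nonneg fun j _ => h₁ i j
  calc 0 < Complex.normSq (μ i j k) := Complex.normSq_pos.2 hk
    _ ≤ ∑ k, Complex.normSq (μ i j k) :=
      Finset.single_le_sum (fun k _ => h₀ i j k) (Finset.mem_univ k)
    _ ≤ ∑ j, ∑ k, Complex.normSq (μ i j k) :=
      Finset.single_le_sum (fun j _ => h₁ i j) (Finset.mem_univ j)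
    _ ≤ normSqV μ := Finset.single_le_sum (fun i _ => h₂ i) (Finset.mem_univ i)

lemma glAct_sub_smul_one (A : Matrix (Fin n) (Fin n) ℂ) (c : ℂ) (μ : Vn n) :
    glAct (A - c • 1) μ = glAct A μ + c • μ := by
  funext i j k
  simp only [glAct_apply, Matrix.sub_apply, Matrix.smul_apply, one_apply, sub_mul,
    Finset.sum_sub_distrib, Pi.add_apply, Pi.smul_apply, smul_eq_mul, mul_ite, ite_mul, mul_one,
    mul_zero, zero_mul, Finset.sum_ite_eq, Finset.sum_ite_eq', Finset.mem_univ, if_true]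
  ring

lemma IsSoliton.isDeriv_Dmat {μ : Vn n} (hμ : IsSymm μ) (h : IsSoliton μ) :
    IsDeriv μ (Dmat μ) := by
  obtain ⟨h₀, c, hc⟩ := h
  have hN := normSqV_pos h₀
  have hcc : cconst μ = -c := by
    have h₁ : (c : ℂ) * normSqV μ = trace (Mmat μ * Mmat μ) := by
      rw [← innerV_glAct μ hμ, hc, ← innerV_self]
      simp [innerV, Finset.mul_sum, mul_assoc]
    rw [cconst, ← h₁, ← Complex.ofReal_mul, Complex.ofReal_re]
    field_simp
  rw [isDeriv_iff_glAct_eq_zero, Dmat, glAct_sub_smul_one, hc, hcc]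
  simp

open scoped ComplexOrder in
lemma cconst_neg {μ : Vn n} (h : μ ≠ 0) (hM : Mmat μ ≠ 0) : cconst μ < 0 := by
  have hps : (Mmat μ * Mmat μ).PosSemidef := by
    simpa [(isHermitian_Mmat μ).eq] using posSemidef_conjTranspose_mul_self (Mmat μ)
  have h₁ : 0 ≤ (trace (Mmat μ * Mmat μ)) := hps.trace_nonneg
  have h₂ : trace (Mmat μ * Mmat μ) ≠ 0 := by
    intro h₃
    apply hM
    rw [← trace_conjTranspose_mul_self_eq_zero_iff, (isHermitian_Mmat μ).eq, h₃]
  have h₃ : 0 < (trace (Mmat μ * Mmat μ)).re := (Complex.pos_iff.1 (h₁.lt_of_ne' h₂)).1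
  rw [cconst, neg_div]
  exact neg_neg_of_pos (div_pos h₃ (normSqV_pos h))

end Vn

/-- A real number killed by every `ℚ`-linear functional that kills `1` is rational. -/
lemma Real.exists_rat_of_forall_dual (r : ℝ) (h : ∀ f : ℝ →ₗ[ℚ] ℚ, f 1 = 0 → f r = 0) :
    ∃ q : ℚ, r = q := by
  by_contra! hr
  have hmem : r ∉ Submodule.span ℚ {(1 : ℝ)} := by
    rw [Submodule.mem_span_singleton]
    rintro ⟨q, hq⟩
    exact hr q (by rw [← hq, Rat.smul_def, mul_one])
  obtain ⟨f, hf, hle⟩ := Submodule.exists_le_ker_of_notMem hmem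
  exact hf (h f (hle (Submodule.mem_span_singleton_self 1)))

namespace Matrix.IsHermitian

variable {n : ℕ} {D : Matrix (Fin n) (Fin n) ℂ} (hD : D.IsHermitian)

/-- Apply a function `f` to the eigenvalues of a Hermitian matrix. -/
def mapEigenvalues (f : ℝ → ℂ) : Matrix (Fin n) (Fin n) ℂ :=
  (hD.eigenvectorUnitary : Matrix (Fin n) (Fin n) ℂ) * diagonal (fun i => f (hD.eigenvalues i)) *
    star (hD.eigenvectorUnitary : Matrix (Fin n) (Fin n) ℂ)

lemma mapEigenvalues_ofReal : hD.mapEigenvalues (fun r => (r : ℂ)) = D := by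
  conv_rhs => rw [hD.spectral_theorem]
  rfl

lemma mapEigenvalues_mulVec_eq_smul_iff (w : Fin n → ℂ) (a : ℂ) (f : ℝ → ℂ) :
    hD.mapEigenvalues f *ᵥ w = a • w ↔
      ∀ i, (star (hD.eigenvectorUnitary : Matrix (Fin n) (Fin n) ℂ) *ᵥ w) i ≠ 0 →
        f (hD.eigenvalues i) = a := by
  set U := (hD.eigenvectorUnitary : Matrix (Fin n) (Fin n) ℂ) with hU
  have h₁ : star U * U = 1 := Unitary.coe_star_mul_self hD.eigenvectorUnitary
  have h₂ : U * star U = 1 := Unitary.coe_mul_star_self hD.eigenvectorUnitary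
  have h₃ : hD.mapEigenvalues f *ᵥ w = a • w ↔
      diagonal (fun i => f (hD.eigenvalues i)) *ᵥ (star U *ᵥ w) = a • (star U *ᵥ w) := by
    simp only [mapEigenvalues, ← hU]
    constructor
    · intro h
      have := congrArg (star U *ᵥ ·) h
      simpa [mulVec_mulVec, ← mul_assoc, h₁, mulVec_smul] using this
    · intro h
      have := congrArg (U *ᵥ ·) h
      simpa [mulVec_mulVec, ← mul_assoc, h₂, mulVec_smul] using this
  rw [h₃, funext_iff]
  refine forall_congr' fun i => ?_
  simp only [mulVec_diagonal, Pi.smul_apply, smul_eq_mul]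
  constructor
  · exact fun h h0 => mul_right_cancel₀ h0 h
  · intro h
    by_cases h0 : (star U *ᵥ w) i = 0
    · simp [h0]
    · rw [h h0]

lemma mapEigenvalues_mulVec {w : Fin n → ℂ} {r : ℝ} (h : D *ᵥ w = (r : ℂ) • w) (f : ℝ → ℂ) :
    hD.mapEigenvalues f *ᵥ w = f r • w := by
  rw [← hD.mapEigenvalues_ofReal, mapEigenvalues_mulVec_eq_smul_iff] at h
  rw [mapEigenvalues_mulVec_eq_smul_iff]
  exact fun i hi => congrArg f (Complex.ofReal_injective (h i hi))

lemma exists_eigenvalues_eq {w : Fin n → ℂ} (hw : w ≠ 0) {a : ℂ} (h : D *ᵥ w = a • w) :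
    ∃ i, a = hD.eigenvalues i := by
  have h₂ : (hD.eigenvectorUnitary : Matrix (Fin n) (Fin n) ℂ) *
      star (hD.eigenvectorUnitary : Matrix (Fin n) (Fin n) ℂ) = 1 :=
    Unitary.coe_mul_star_self hD.eigenvectorUnitary
  rw [← hD.mapEigenvalues_ofReal, mapEigenvalues_mulVec_eq_smul_iff] at h
  have h₀ : star (hD.eigenvectorUnitary : Matrix (Fin n) (Fin n) ℂ) *ᵥ w ≠ 0 := by
    intro h₀
    apply hw
    rw [← one_mulVec w, ← h₂, ← mulVec_mulVec, h₀, mulVec_zero]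
  obtain ⟨i, hi⟩ := Function.ne_iff.1 h₀
  exact ⟨i, (h i hi).symm⟩

lemma trace_mapEigenvalues_mul_sub_one (f : ℝ → ℂ) :
    trace (hD.mapEigenvalues f * (D - 1)) =
      ∑ i, f (hD.eigenvalues i) * (hD.eigenvalues i - 1) := by
  have h₁ : star (hD.eigenvectorUnitary : Matrix (Fin n) (Fin n) ℂ) *
      (hD.eigenvectorUnitary : Matrix (Fin n) (Fin n) ℂ) = 1 :=
    Unitary.coe_star_mul_self hD.eigenvectorUnitary
  have h₂ : hD.mapEigenvalues f * D = hD.mapEigenvalues fun r => f r * r := by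
    trans hD.mapEigenvalues f * hD.mapEigenvalues fun r => (r : ℂ)
    · rw [hD.mapEigenvalues_ofReal]
    · simp only [mapEigenvalues]
      rw [mul_assoc, ← mul_assoc (star _), ← mul_assoc (star _), h₁, one_mul, ← mul_assoc,
        mul_assoc _ (diagonal _) (diagonal _), diagonal_mul_diagonal]
  have h₃ : ∀ g : ℝ → ℂ, trace (hD.mapEigenvalues g) = ∑ i, g (hD.eigenvalues i) := by
    intro g
    rw [mapEigenvalues, mul_assoc, trace_mul_comm, mul_assoc, h₁, mul_one, trace_diagonal]
  rw [mul_sub, mul_one, trace_sub, h₂, h₃, h₃, ← Finset.sum_sub_distrib]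
  simp only [mul_sub, mul_one]

end Matrix.IsHermitian

/-- Additive functions of the eigenvalues of a Hermitian derivation are derivations. -/
lemma Vn.IsDeriv.mapEigenvalues {n : ℕ} {μ : Vn n} {D : Matrix (Fin n) (Fin n) ℂ}
    (hD : D.IsHermitian) (h : Vn.IsDeriv μ D) (f : ℝ →+ ℂ) :
    Vn.IsDeriv μ (hD.mapEigenvalues f) := by
  let b := hD.eigenvectorBasis.toBasis.map (WithLp.linearEquiv 2 ℂ (Fin n → ℂ))
  have hb : ∀ i, D *ᵥ b i = (hD.eigenvalues i : ℂ) • b i := fun i =>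
    hD.mulVec_eigenvectorBasis i
  refine Vn.IsDeriv.of_basis b fun i j => ?_
  have hij : D *ᵥ Vn.mul μ (b i) (b j) =
      ((hD.eigenvalues i + hD.eigenvalues j : ℝ) : ℂ) • Vn.mul μ (b i) (b j) := by
    rw [h, hb, hb, Vn.mul_smul_left, Vn.mul_smul_right, ← add_smul, Complex.ofReal_add]
  rw [hD.mapEigenvalues_mulVec hij, hD.mapEigenvalues_mulVec (hb i),
    hD.mapEigenvalues_mulVec (hb j), Vn.mul_smul_left, Vn.mul_smul_right, ← add_smul, map_add]

/-- A Hermitian derivation `D` with `tr (A (D - 1)) = 0` for every derivation `A` has rational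
eigenvalues. -/
lemma Vn.IsDeriv.eigenvalues_rational {n : ℕ} {μ : Vn n} {D : Matrix (Fin n) (Fin n) ℂ}
    (hD : D.IsHermitian) (h : Vn.IsDeriv μ D)
    (htr : ∀ A, Vn.IsDeriv μ A → trace (A * (D - 1)) = 0) (i : Fin n) :
    ∃ q : ℚ, hD.eigenvalues i = q := by
  refine Real.exists_rat_of_forall_dual _ fun f hf => ?_
  let g : ℝ →+ ℂ := (Rat.castHom ℂ).toAddMonoidHom.comp f.toAddMonoidHom
  have h₁ := htr _ (h.mapEigenvalues hD g)
  rw [hD.trace_mapEigenvalues_mul_sub_one] at h₁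
  have h₂ : ∑ j, f (hD.eigenvalues j) • (hD.eigenvalues j - 1) = 0 := by
    apply Complex.ofReal_injective
    simpa [Rat.smul_def, g] using h₁
  have h₃ : ∑ j, f (hD.eigenvalues j) * f (hD.eigenvalues j) = 0 := by
    simpa [hf] using congrArg f h₂
  exact mul_self_eq_zero.1
    ((Finset.sum_eq_zero_iff_of_nonneg fun j _ => mul_self_nonneg _).1 h₃ i (Finset.mem_univ i))

/-- if a nonzero `μ ∈ V_n` is a soliton then some positive real multiple of
`D_μ = M_μ - c_μ I` has all its eigenvalues rational. -/
theorem stmt4 {n : ℕ} (μ : Vn n) (hμ : Vn.IsSymm μ) (h : Vn.IsSoliton μ) :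
    ∃ t : ℝ, 0 < t ∧ ∀ (d : ℂ) (x : Fin n → ℂ), x ≠ 0 →
      (t • Vn.Dmat μ) *ᵥ x = d • x → ∃ q : ℚ, d = (q : ℂ) := by
  by_cases hM : Vn.Mmat μ = 0
  · refine ⟨1, one_pos, fun d x hx hd => ⟨0, ?_⟩⟩
    have hd' : d • x = 0 := by
      rw [← hd]
      simp [Vn.Dmat, Vn.cconst, hM]
    simpa [hx] using hd'
  have hc : Vn.cconst μ < 0 := Vn.cconst_neg h.1 hM
  set c := Vn.cconst μ with hcdef
  have hc' : (c : ℂ) ≠ 0 := by exact_mod_cast hc.ne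
  refine ⟨(-c)⁻¹, inv_pos.2 (neg_pos.2 hc), fun d x hx hd => ?_⟩
  have hsmul : (-c)⁻¹ • Vn.Dmat μ = (-(c : ℂ))⁻¹ • Vn.Dmat μ := by
    ext i j
    simp
  have hsub : (-(c : ℂ))⁻¹ • Vn.Dmat μ - 1 = (-(c : ℂ))⁻¹ • Vn.Mmat μ := by
    rw [Vn.Dmat, ← hcdef, smul_sub, smul_smul, inv_neg, neg_mul, inv_mul_cancel₀ hc']
    simp
  have hH : ((-(c : ℂ))⁻¹ • Vn.Dmat μ).IsHermitian := by
    rw [sub_eq_iff_eq_add.1 hsub]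
    ext i j
    simp [(Vn.isHermitian_Mmat μ).apply, one_apply, eq_comm]
  rw [hsmul] at hd
  obtain ⟨i, rfl⟩ := hH.exists_eigenvalues_eq hx hd
  obtain ⟨q, hq⟩ := ((h.isDeriv_Dmat hμ).smul _).eigenvalues_rational hH (fun A hA => by
    rw [hsub, Matrix.mul_smul, trace_smul, ← Vn.innerV_glAct μ hμ,
      (Vn.isDeriv_iff_glAct_eq_zero μ A).1 hA]
    simp [Vn.innerV]) i
  exact ⟨q, by rw [hq]; simp⟩
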